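/- For every integer j ≥ 1 and every integer k ≥ 0, the coefficient C(j,k) := 𝔤_j^{(k)}(0)/(j+1)! of the function 𝔤_j(v) = (e^v − 1)^{j+1} f_j(v) satisfies C(j,k)/(j!·k!) = Σ_{r=0}^{k} binom(j+r, j) · ((-1)^{r+1} B_{r+1}/(r+1)!) · S(k-r, j+1)/(k-r)!. -/

import Mathlib

/-- `G_j(v) = v^j/(1 - e^{-v})` for `v ≠ 0`, `G_1(0) = 1`, and `G_j(0) = 0` for `j > 1`. -/
noncomputable def G (j : ℕ) : ℝ → ℝ := fun v =>
  if v = 0 then (if j = 1 then 1 else 0) else v ^ j / (1 - Real.exp (-v))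

/-- `𝔤_j(v) = (e^v − 1)^{j+1} f_j(v)` where `f_j = G_j^{(j)}`. -/
noncomputable def frakg (j : ℕ) : ℝ → ℝ := fun v =>
  (Real.exp v - 1) ^ (j + 1) * iteratedDeriv j (G j) v

/-- The Stirling numbers of the second kind `S(n,k)`. -/
def S : ℕ → ℕ → ℕ
  | 0, 0 => 1
  | 0, _ + 1 => 0
  | _ + 1, 0 => 0
  | n + 1, k + 1 => (k + 1) * S n (k + 1) + S n k

open Nat in
/-- The formal Taylor series at `0` of a real function. -/
noncomputable def taylorSeriesZero (f : ℝ → ℝ) : PowerSeries ℝ :=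
  PowerSeries.mk fun n => iteratedDeriv n f 0 / n !

lemma coeff_taylorSeriesZero (f : ℝ → ℝ) (n : ℕ) :
    PowerSeries.coeff n (taylorSeriesZero f) = iteratedDeriv n f 0 / (Nat.factorial n) := by
  simp [taylorSeriesZero]

lemma taylorSeriesZero_mul {f g : ℝ → ℝ} (hf : AnalyticAt ℝ f 0) (hg : AnalyticAt ℝ g 0) :
    taylorSeriesZero (f * g) = taylorSeriesZero f * taylorSeriesZero g := by
  ext n
  rw [PowerSeries.coeff_mul, coeff_taylorSeriesZero, iteratedDeriv_mul hf.contDiffAt hg.contDiffAt,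
    Finset.Nat.sum_antidiagonal_eq_sum_range_succ_mk, Finset.sum_div]
  refine Finset.sum_congr rfl fun i hi => ?_
  have hin : i ≤ n := Nat.lt_succ_iff.mp (Finset.mem_range.mp hi)
  rw [coeff_taylorSeriesZero, coeff_taylorSeriesZero, Nat.cast_choose ℝ hin]
  have h1 := Nat.cast_ne_zero (R := ℝ).mpr (Nat.factorial_ne_zero n)
  have h2 := Nat.cast_ne_zero (R := ℝ).mpr (Nat.factorial_ne_zero i)
  have h3 := Nat.cast_ne_zero (R := ℝ).mpr (Nat.factorial_ne_zero (n - i))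
  field_simp

lemma taylorSeriesZero_pow_id (m : ℕ) :
    taylorSeriesZero (fun v => v ^ m) = PowerSeries.X ^ m := by
  ext n
  rw [coeff_taylorSeriesZero, iteratedDeriv_fun_pow_zero, PowerSeries.coeff_X_pow]
  split_ifs with h
  · subst h
    exact div_self (Nat.cast_ne_zero.mpr (Nat.factorial_ne_zero _))
  · simp

lemma taylorSeriesZero_exp : taylorSeriesZero Real.exp = PowerSeries.exp ℝ := by
  ext n
  rw [coeff_taylorSeriesZero, iteratedDeriv_eq_iterate, Real.iter_deriv_exp, PowerSeries.coeff_exp]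
  simp

lemma taylorSeriesZero_exp_sub_one :
    taylorSeriesZero (fun v => Real.exp v - 1) = PowerSeries.exp ℝ - 1 := by
  have h : taylorSeriesZero (fun v => Real.exp v - 1) =
      taylorSeriesZero Real.exp - taylorSeriesZero (fun v => v ^ 0) := by
    ext n
    rw [map_sub, coeff_taylorSeriesZero, coeff_taylorSeriesZero, coeff_taylorSeriesZero, ← sub_div]
    congr 1
    simp only [pow_zero]
    exact iteratedDeriv_fun_sub Real.contDiff_exp.contDiffAt contDiffAt_const
  rw [h, taylorSeriesZero_exp, taylorSeriesZero_pow_id, pow_zero]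

lemma analyticAt_exp_sub_one_pow (m : ℕ) :
    AnalyticAt ℝ (fun v : ℝ => (Real.exp v - 1) ^ m) 0 := by
  fun_prop

lemma taylorSeriesZero_exp_sub_one_pow (m : ℕ) :
    taylorSeriesZero (fun v => (Real.exp v - 1) ^ m) = (PowerSeries.exp ℝ - 1) ^ m := by
  induction m with
  | zero => simpa using taylorSeriesZero_pow_id 0
  | succ m ih =>
    rw [pow_succ, ← ih, ← taylorSeriesZero_exp_sub_one,
      ← taylorSeriesZero_mul (analyticAt_exp_sub_one_pow m)
        (by simpa using analyticAt_exp_sub_one_pow 1)]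
    rfl

/-- The exponential generating function of the Stirling numbers of the second kind. -/
lemma coeff_exp_sub_one_pow (n m : ℕ) :
    PowerSeries.coeff n ((PowerSeries.exp ℝ - 1) ^ m) =
      (Nat.factorial m) * ((S n m : ℝ) / (Nat.factorial n)) := by
  induction n generalizing m with
  | zero => cases m <;> simp [S]
  | succ n ih =>
    cases m with
    | zero => simp [S, PowerSeries.coeff_one]
    | succ m =>
      have hd : PowerSeries.derivative ℝ ((PowerSeries.exp ℝ - 1) ^ (m + 1)) =
          ((m + 1 : ℕ) : PowerSeries ℝ) *
            ((PowerSeries.exp ℝ - 1) ^ (m + 1) + (PowerSeries.exp ℝ - 1) ^ m) := by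
        rw [PowerSeries.derivative_pow, map_sub, PowerSeries.derivative_exp,
          PowerSeries.derivative_one, Nat.add_sub_cancel]
        ring
      have hc := congrArg (PowerSeries.coeff n) hd
      rw [PowerSeries.coeff_derivative, ← nsmul_eq_mul, map_nsmul, map_add, ih, ih,
        nsmul_eq_mul] at hc
      have hn : (n + 1 : ℝ) ≠ 0 := by positivity
      rw [eq_div_of_mul_eq hn hc]
      simp only [S, Nat.factorial_succ]
      push_cast
      have h1 := Nat.cast_ne_zero (R := ℝ).mpr (Nat.factorial_ne_zero n)
      field_simp

lemma G_one_eq_inv_dslope :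
    G 1 = fun v => (dslope (fun w : ℝ => 1 - Real.exp (-w)) 0 v)⁻¹ := by
  funext v
  by_cases hv : v = 0
  · subst hv
    have hd : HasDerivAt (fun w : ℝ => 1 - Real.exp (-w)) 1 0 := by
      simpa using ((hasDerivAt_neg (0 : ℝ)).exp.const_sub 1)
    simp [G, dslope_same, hd.deriv]
  · simp [G, hv, dslope_of_ne, slope_def_field]

lemma analyticAt_G_one : AnalyticAt ℝ (G 1) 0 := by
  have hf : AnalyticAt ℝ (fun w : ℝ => 1 - Real.exp (-w)) 0 := by fun_prop
  obtain ⟨p, hp⟩ := hf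
  have h0 : dslope (fun w : ℝ => 1 - Real.exp (-w)) 0 0 ≠ 0 := by
    intro h
    have h1 := congrFun G_one_eq_inv_dslope 0
    rw [h, inv_zero] at h1
    simp [G] at h1
  rw [G_one_eq_inv_dslope]
  exact AnalyticAt.fun_inv ⟨_, hp.has_fpower_series_dslope_fslope⟩ h0

lemma G_one_mul_exp_sub_one :
    G 1 * (fun v => Real.exp v - 1) = (fun v => v ^ 1) * Real.exp := by
  funext v
  by_cases hv : v = 0
  · simp [hv]
  · have h1 : Real.exp v - 1 ≠ 0 := by
      simpa [sub_eq_zero] using hv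
    have h2 := Real.exp_ne_zero v
    simp only [Pi.mul_apply, G, hv, if_false, Real.exp_neg]
    have h3 : 1 - (Real.exp v)⁻¹ = (Real.exp v - 1) / Real.exp v := by field_simp
    rw [h3]
    field_simp

lemma taylorSeriesZero_G_one : taylorSeriesZero (G 1) = bernoulli'PowerSeries ℝ := by
  have hne : PowerSeries.exp ℝ - 1 ≠ 0 := by
    intro h
    simpa [PowerSeries.coeff_one, PowerSeries.coeff_exp] using congrArg (PowerSeries.coeff 1) h
  apply mul_right_cancel₀ hne
  rw [bernoulli'PowerSeries_mul_exp_sub_one, ← taylorSeriesZero_exp_sub_one,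
    ← taylorSeriesZero_mul analyticAt_G_one (by fun_prop), G_one_mul_exp_sub_one,
    taylorSeriesZero_mul (by fun_prop) (by fun_prop), taylorSeriesZero_exp,
    taylorSeriesZero_pow_id, pow_one]

lemma G_succ (j : ℕ) : G (j + 1) = (fun v => v ^ j) * G 1 := by
  funext v
  by_cases hv : v = 0
  · cases j <;> simp [G, hv]
  · simp [G, hv, pow_succ, mul_div_assoc]

lemma analyticAt_G_succ (j : ℕ) : AnalyticAt ℝ (G (j + 1)) 0 := by
  rw [G_succ]
  exact AnalyticAt.mul (by fun_prop) analyticAt_G_one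

lemma taylorSeriesZero_G_succ (j : ℕ) :
    taylorSeriesZero (G (j + 1)) = PowerSeries.X ^ j * bernoulli'PowerSeries ℝ := by
  rw [G_succ, taylorSeriesZero_mul (by fun_prop) analyticAt_G_one, taylorSeriesZero_pow_id,
    taylorSeriesZero_G_one]

lemma coeff_taylorSeriesZero_iteratedDeriv (f : ℝ → ℝ) (j r : ℕ) :
    PowerSeries.coeff r (taylorSeriesZero (iteratedDeriv j f)) =
      (Nat.choose (j + r) j) * (Nat.factorial j) *
        PowerSeries.coeff (j + r) (taylorSeriesZero f) := by
  have h : iteratedDeriv r (iteratedDeriv j f) = iteratedDeriv (j + r) f := by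
    simp only [iteratedDeriv_eq_iterate, ← Function.iterate_add_apply, add_comm]
  rw [coeff_taylorSeriesZero, coeff_taylorSeriesZero, h, Nat.cast_add_choose]
  have h1 := Nat.cast_ne_zero (R := ℝ).mpr (Nat.factorial_ne_zero r)
  have h2 := Nat.cast_ne_zero (R := ℝ).mpr (Nat.factorial_ne_zero j)
  have h3 := Nat.cast_ne_zero (R := ℝ).mpr (Nat.factorial_ne_zero (j + r))
  field_simp

lemma coeff_taylorSeriesZero_iteratedDeriv_G (j r : ℕ) (hj : 1 ≤ j) :
    PowerSeries.coeff r (taylorSeriesZero (iteratedDeriv j (G j))) =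
      (Nat.choose (j + r) j) * (Nat.factorial j) *
        ((-1 : ℝ) ^ (r + 1) * ((bernoulli (r + 1) : ℚ) : ℝ) / (Nat.factorial (r + 1))) := by
  obtain ⟨i, rfl⟩ := Nat.exists_eq_add_of_le' hj
  rw [coeff_taylorSeriesZero_iteratedDeriv, taylorSeriesZero_G_succ,
    show i + 1 + r = r + 1 + i by ring, PowerSeries.coeff_X_pow_mul, bernoulli'PowerSeries,
    PowerSeries.coeff_mk, bernoulli'_eq_bernoulli]
  simp


/-- Bernoulli-number form of the coefficients `C(j,k) = 𝔤_j^{(k)}(0)/(j+1)!`: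
`C(j,k)/(j!k!) = Σ_{r=0}^{k} binom(j+r,j) ((-1)^{r+1} B_{r+1}/(r+1)!) S(k-r,j+1)/(k-r)!`. -/
theorem C_bernoulli (j k : ℕ) (hj : 1 ≤ j) :
    (iteratedDeriv k (frakg j) 0 / (Nat.factorial (j + 1))) /
        ((Nat.factorial j) * (Nat.factorial k)) =
      ∑ r ∈ Finset.range (k + 1),
        (Nat.choose (j + r) j : ℝ) *
          ((-1 : ℝ) ^ (r + 1) * ((bernoulli (r + 1) : ℚ) : ℝ) / (Nat.factorial (r + 1))) *
          ((S (k - r) (j + 1) : ℝ) / (Nat.factorial (k - r))) := by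
  have hA : AnalyticAt ℝ (iteratedDeriv j (G j)) 0 := by
    obtain ⟨i, rfl⟩ := Nat.exists_eq_add_of_le' hj
    rw [iteratedDeriv_eq_iterate]
    exact (analyticAt_G_succ i).iterated_deriv _
  have hT : taylorSeriesZero (frakg j) =
      taylorSeriesZero (iteratedDeriv j (G j)) * (PowerSeries.exp ℝ - 1) ^ (j + 1) := by
    rw [mul_comm, ← taylorSeriesZero_exp_sub_one_pow,
      ← taylorSeriesZero_mul (analyticAt_exp_sub_one_pow _) hA]
    rfl
  have hk : iteratedDeriv k (frakg j) 0 / (Nat.factorial (j + 1)) /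
      ((Nat.factorial j) * (Nat.factorial k)) =
      PowerSeries.coeff k (taylorSeriesZero (frakg j)) /
        ((Nat.factorial (j + 1)) * (Nat.factorial j)) := by
    rw [coeff_taylorSeriesZero]
    simp only [div_div]
    ring
  rw [hk, hT, PowerSeries.coeff_mul, Finset.Nat.sum_antidiagonal_eq_sum_range_succ_mk,
    Finset.sum_div]
  refine Finset.sum_congr rfl fun r _ => ?_
  rw [coeff_taylorSeriesZero_iteratedDeriv_G j r hj, coeff_exp_sub_one_pow]
  have h1 := Nat.cast_ne_zero (R := ℝ).mpr (Nat.factorial_ne_zero j)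
  have h2 := Nat.cast_ne_zero (R := ℝ).mpr (Nat.factorial_ne_zero (j + 1))
  generalize (-1 : ℝ) ^ (r + 1) * ((bernoulli (r + 1) : ℚ) : ℝ) / (Nat.factorial (r + 1)) = b
  generalize (S (k - r) (j + 1) : ℝ) / (Nat.factorial (k - r)) = s
  field_simp
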